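/- Let Γ be a group and Λ ⊴ Γ a normal subgroup such that every quasimorphism on Γ/Λ is bounded (i.e. Q(Γ/Λ) = 0). Then the restriction map Q(Γ) → Q(Λ) is injective; equivalently, every quasimorphism on Γ whose restriction to Λ is bounded is itself bounded. -/

import Mathlib

/-- A real-valued function is bounded if its absolute value has a uniform bound. -/
def BddFun {α : Type*} (f : α → ℝ) : Prop := ∃ C : ℝ, ∀ x, |f x| ≤ C

/-- A quasimorphism on a group `G`: a function `q : G → ℝ` such that
`|q g + q h - q (g * h)|` is uniformly bounded. -/
def IsQuasimorphism (G : Type*) [Group G] (q : G → ℝ) : Prop :=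
  ∃ D : ℝ, ∀ g h : G, |q g + q h - q (g * h)| ≤ D

/-- **Lemma.** Let `Γ` be a group and `Λ ⊴ Γ` a normal subgroup such that every
quasimorphism on `Γ/Λ` is bounded (i.e. `Q(Γ/Λ) = 0`). Then the restriction map
`Q(Γ) → Q(Λ)` is injective: every quasimorphism on `Γ` whose restriction to `Λ` is
bounded is itself bounded. -/
theorem quasimorphism_restriction_injective {G : Type*} [Group G] (N : Subgroup G)
    [N.Normal] (hQ : ∀ q : G ⧸ N → ℝ, IsQuasimorphism (G ⧸ N) q → BddFun q) :
    ∀ q : G → ℝ, IsQuasimorphism G q → BddFun (fun x : ↥N => q x) → BddFun q := by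
  rintro q ⟨D, hD⟩ ⟨C, hC⟩
  have near : ∀ g : G, |q (Quotient.out (g : G ⧸ N)) - q g| ≤ C + D := by
    intro g
    have hmem : (Quotient.out (g : G ⧸ N))⁻¹ * g ∈ N :=
      QuotientGroup.eq.mp (QuotientGroup.out_eq' (g : G ⧸ N))
    have h₁ := abs_le.mp (hC ⟨_, hmem⟩)
    have h₂ := abs_le.mp (hD (Quotient.out (g : G ⧸ N)) ((Quotient.out (g : G ⧸ N))⁻¹ * g))
    rw [mul_inv_cancel_left] at h₂
    dsimp only at h₁
    rw [abs_le]
    constructor <;> linarith [h₁.1, h₁.2, h₂.1, h₂.2]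
  obtain ⟨B, hB⟩ := hQ (fun x => q (Quotient.out x)) ⟨C + D + D, fun a b => by
    have h₁ := abs_le.mp (near (Quotient.out a * Quotient.out b))
    rw [QuotientGroup.mk_mul, QuotientGroup.out_eq', QuotientGroup.out_eq'] at h₁
    have h₂ := abs_le.mp (hD (Quotient.out a) (Quotient.out b))
    rw [abs_le]
    constructor <;> linarith [h₁.1, h₁.2, h₂.1, h₂.2]⟩
  refine ⟨B + (C + D), fun g => ?_⟩
  have h₁ := abs_le.mp (near g)
  have h₂ := abs_le.mp (hB (g : G ⧸ N))
  rw [abs_le]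
  constructor <;> linarith [h₁.1, h₁.2, h₂.1, h₂.2]
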